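/- Let S_1 ⊇ S_2 ⊇ … ⊇ S_T be nested nonempty compact convex subsets of ℝ², each of diameter at most D, and let r_t ≥ 0 be numbers such that for each t ≥ 2, either Perimeter(S_{t-1}) − Perimeter(S_t) ≥ c·r_t or Area(S_{t-1}) − Area(S_t) ≥ c·r_t² for a fixed constant c > 0. Then Σ_{t=2}^T r_t ≤ (π D)/c + √(T · D²/c); in particular Σ_t r_t = O(√T) and if additionally each r_t ≤ D·T^{-1/3} control is available the sum is O(T^{1/3}). -/

import Mathlib

open MeasureTheory Metric Real

theorem exists_supporting_normal {E : Type*} [NormedAddCommGroup E] [InnerProductSpace ℝ E]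
    [FiniteDimensional ℝ E] {K : Set E} (hK : Convex ℝ K) {x : E} (hxK : x ∈ K)
    (hx : x ∉ interior K) : ∃ u : E, u ≠ 0 ∧ ∀ w ∈ K, inner ℝ u (w - x) ≤ 0 := by
  by_cases hint : (interior K).Nonempty
  · obtain ⟨f, hf, hfx⟩ := geometric_hahn_banach_of_nonempty_interior_point hK hx hint
    refine ⟨(InnerProductSpace.toDual ℝ E).symm f, by simpa using hf, fun w hw => ?_⟩
    simpa using hfx w hw
  · rw [hK.interior_nonempty_iff_affineSpan_eq_top] at hint
    have hdir : (affineSpan ℝ K).direction ≠ ⊤ := fun h =>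
      hint ((AffineSubspace.direction_eq_top_iff_of_nonempty
        ⟨x, subset_affineSpan ℝ K hxK⟩).1 h)
    obtain ⟨u, hu, hu0⟩ := Submodule.exists_mem_ne_zero_of_ne_bot
      (mt (Submodule.orthogonal_eq_bot_iff).1 hdir)
    refine ⟨u, hu0, fun w hw => le_of_eq ?_⟩
    exact (Submodule.mem_orthogonal' _ _).1 hu _ (AffineSubspace.vsub_mem_direction
      (subset_affineSpan ℝ K hw) (subset_affineSpan ℝ K hxK))

theorem hausdorffMeasure_frontier_le_of_forall_ray_mem {E : Type*} [NormedAddCommGroup E]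
    [InnerProductSpace ℝ E] [FiniteDimensional ℝ E] [MeasurableSpace E] [BorelSpace E]
    {K G : Set E} (hKc : IsClosed K) (hK : Convex ℝ K)
    (hG : ∀ x ∈ K, ∀ u : E, u ≠ 0 → ∃ s : ℝ, 0 ≤ s ∧ x + s • u ∈ G) :
    μH[1] (frontier K) ≤ μH[1] G := by
  set A : Set E := {y | y ∈ G ∧ ∃ x ∈ K, ∀ w ∈ K, inner ℝ (y - x) (w - x) ≤ 0}
  have hA : ∀ y : E, ∃ x, y ∈ A → x ∈ K ∧ ∀ w ∈ K, inner ℝ (y - x) (w - x) ≤ 0 := fun y => by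
    by_cases hy : y ∈ A
    · obtain ⟨-, x, hx⟩ := hy
      exact ⟨x, fun _ => hx⟩
    · exact ⟨0, fun h => absurd h hy⟩
  choose p hp using hA
  have key : ∀ y₁ y₂ x₁ x₂ : E, inner ℝ (y₁ - x₁) (x₂ - x₁) ≤ 0 →
      inner ℝ (y₂ - x₂) (x₁ - x₂) ≤ 0 → ‖x₁ - x₂‖ ≤ ‖y₁ - y₂‖ := by
    intro y₁ y₂ x₁ x₂ h₁ h₂
    have h : ‖x₁ - x₂‖ * ‖x₁ - x₂‖ ≤ inner ℝ (y₁ - y₂) (x₁ - x₂) := by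
      rw [← real_inner_self_eq_norm_mul_norm]
      simp only [inner_sub_left, inner_sub_right] at h₁ h₂ ⊢
      linarith
    have h' := h.trans (real_inner_le_norm _ _)
    rcases (norm_nonneg (x₁ - x₂)).eq_or_lt with h0 | h0
    · rw [← h0]; positivity
    · exact le_of_mul_le_mul_right h' h0
  have hlip : LipschitzOnWith 1 p A := by
    refine LipschitzOnWith.of_dist_le_mul fun y₁ h₁ y₂ h₂ => ?_
    rw [NNReal.coe_one, one_mul, dist_eq_norm, dist_eq_norm]
    exact key _ _ _ _ ((hp _ h₁).2 _ (hp _ h₂).1) ((hp _ h₂).2 _ (hp _ h₁).1)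
  have hsub : frontier K ⊆ p '' A := by
    intro x hx
    have hxK : x ∈ K := hKc.frontier_subset hx
    obtain ⟨u, hu0, hu⟩ := exists_supporting_normal hK hxK hx.2
    obtain ⟨s, hs, hsG⟩ := hG x hxK u hu0
    have hn : ∀ w ∈ K, inner ℝ (x + s • u - x) (w - x) ≤ 0 := fun w hw => by
      rw [add_sub_cancel_left, real_inner_smul_left]
      exact mul_nonpos_of_nonneg_of_nonpos hs (hu w hw)
    have hyA : x + s • u ∈ A := ⟨hsG, x, hxK, hn⟩
    refine ⟨_, hyA, ?_⟩
    have := key _ _ _ _ ((hp _ hyA).2 x hxK) (hn _ (hp _ hyA).1)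
    rw [sub_self, norm_zero] at this
    exact sub_eq_zero.1 (norm_le_zero_iff.1 this)
  calc μH[1] (frontier K) ≤ μH[1] (p '' A) := measure_mono hsub
    _ ≤ μH[1] A := by simpa using hlip.hausdorffMeasure_image_le zero_le_one
    _ ≤ μH[1] G := measure_mono fun y hy => hy.1

theorem IsCompact.exists_ray_mem_frontier {E : Type*} [NormedAddCommGroup E] [NormedSpace ℝ E]
    {K : Set E} (hK : IsCompact K) {x u : E} (hx : x ∈ K) (hu : u ≠ 0) :
    ∃ s : ℝ, 0 ≤ s ∧ x + s • u ∈ frontier K := by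
  have hcont : Continuous fun s : ℝ => x + s • u := by fun_prop
  have hcpt : IsCompact {s : ℝ | 0 ≤ s ∧ x + s • u ∈ K} := by
    refine Metric.isCompact_of_isClosed_isBounded
      (isClosed_Ici.inter (hK.isClosed.preimage hcont)) ?_
    obtain ⟨R, hR⟩ := hK.isBounded.exists_norm_le
    refine (Metric.isBounded_Icc (0 : ℝ) ((R + ‖x‖) / ‖u‖)).subset fun s hs => ⟨hs.1, ?_⟩
    rw [le_div_iff₀ (norm_pos_iff.2 hu)]
    calc s * ‖u‖ = ‖(x + s • u) - x‖ := by
          rw [add_sub_cancel_left, norm_smul, Real.norm_of_nonneg hs.1]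
      _ ≤ ‖x + s • u‖ + ‖x‖ := norm_sub_le _ _
      _ ≤ R + ‖x‖ := by gcongr; exact hR _ hs.2
  obtain ⟨s, hs, hmax⟩ := hcpt.exists_isMaxOn ⟨0, by simpa using hx⟩ continuousOn_id
  refine ⟨s, hs.1, subset_closure hs.2, fun hsi => ?_⟩
  have hnhds : (fun s : ℝ => x + s • u) ⁻¹' interior K ∈ nhds s :=
    (isOpen_interior.preimage hcont).mem_nhds hsi
  obtain ⟨t, ht, hst⟩ := ((Filter.Eventually.filter_mono nhdsWithin_le_nhds
    hnhds : ∀ᶠ t in nhdsWithin s (Set.Ioi s), x + t • u ∈ interior K).and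
      self_mem_nhdsWithin).exists
  exact not_lt_of_ge (hmax ⟨hs.1.trans (le_of_lt hst), interior_subset ht⟩) hst

theorem hausdorffMeasure_frontier_mono {E : Type*} [NormedAddCommGroup E]
    [InnerProductSpace ℝ E] [FiniteDimensional ℝ E] [MeasurableSpace E] [BorelSpace E]
    {K L : Set E} (hKc : IsClosed K) (hK : Convex ℝ K) (hL : IsCompact L) (hKL : K ⊆ L) :
    μH[1] (frontier K) ≤ μH[1] (frontier L) :=
  hausdorffMeasure_frontier_le_of_forall_ray_mem hKc hK fun _ hx _ hu =>
    hL.exists_ray_mem_frontier (hKL hx) hu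

/-- The part of the line with normal `(cos θ, sin θ)` and offset `b` cut out by the half-planes
with normals at angles `θ - δ`, `θ + δ` and offsets `a`, `c`. -/
def tangentEdge (θ δ a b c : ℝ) : Set (EuclideanSpace ℝ (Fin 2)) :=
  {y | y 0 * cos θ + y 1 * sin θ = b ∧ y 0 * cos (θ - δ) + y 1 * sin (θ - δ) ≤ a ∧
    y 0 * cos (θ + δ) + y 1 * sin (θ + δ) ≤ c}

theorem tangentEdge_coord_mem {θ δ a b c : ℝ} (hδ : 0 < sin δ) {y : EuclideanSpace ℝ (Fin 2)}
    (hy : y ∈ tangentEdge θ δ a b c) :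
    -y 0 * sin θ + y 1 * cos θ ∈
      Set.Icc (-((a - b * cos δ) / sin δ)) ((c - b * cos δ) / sin δ) := by
  obtain ⟨h₁, h₂, h₃⟩ := hy
  rw [cos_sub, sin_sub] at h₂
  rw [cos_add, sin_add] at h₃
  rw [Set.mem_Icc, neg_le, le_div_iff₀ hδ, le_div_iff₀ hδ, ← h₁]
  constructor <;> linarith

theorem tangentEdge_length_nonneg {θ δ a b c : ℝ} (hδ : 0 < sin δ)
    (hy : (tangentEdge θ δ a b c).Nonempty) : 0 ≤ (a + c - 2 * b * cos δ) / sin δ := by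
  obtain ⟨y, hy⟩ := hy
  obtain ⟨h₁, h₂⟩ := tangentEdge_coord_mem hδ hy
  have : (a + c - 2 * b * cos δ) / sin δ =
      (c - b * cos δ) / sin δ - -((a - b * cos δ) / sin δ) := by ring
  linarith

theorem hausdorffMeasure_tangentEdge_le {θ δ a b c : ℝ} (hδ : 0 < sin δ) :
    μH[1] (tangentEdge θ δ a b c) ≤ ENNReal.ofReal ((a + c - 2 * b * cos δ) / sin δ) := by
  set f : ℝ → EuclideanSpace ℝ (Fin 2) := fun τ =>
    !₂[b * cos θ - τ * sin θ, b * sin θ + τ * cos θ] with hf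
  have hiso : Isometry f := Isometry.of_dist_eq fun s t => by
    rw [EuclideanSpace.dist_eq, Real.dist_eq, ← Real.sqrt_sq_eq_abs]
    congr 1
    simp only [hf, Fin.sum_univ_two, Real.dist_eq, sq_abs, PiLp.toLp_apply, Matrix.cons_val_zero,
      Matrix.cons_val_one]
    linear_combination (s - t) ^ 2 * sin_sq_add_cos_sq θ
  have hsub : tangentEdge θ δ a b c ⊆
      f '' Set.Icc (-((a - b * cos δ) / sin δ)) ((c - b * cos δ) / sin δ) := by
    intro y hy
    refine ⟨_, tangentEdge_coord_mem hδ hy, ?_⟩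
    ext i
    fin_cases i
    · simp only [hf, ← hy.1, PiLp.toLp_apply, Fin.zero_eta, Matrix.cons_val_zero]
      linear_combination y 0 * sin_sq_add_cos_sq θ
    · simp only [hf, ← hy.1, PiLp.toLp_apply, Fin.mk_one, Matrix.cons_val_one,
        Matrix.cons_val_fin_one]
      linear_combination y 1 * sin_sq_add_cos_sq θ
  refine (measure_mono hsub).trans_eq ?_
  rw [hiso.hausdorffMeasure_image (Or.inl zero_le_one), hausdorffMeasure_real, Real.volume_Icc]
  congr 1
  ring

theorem sum_range_shift_of_periodic {M : Type*} [AddCommMonoid M] (g : ℝ → M) (δ : ℝ) (N : ℕ)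
    (hg : g (N * δ) = g 0) :
    ∑ i ∈ Finset.range N, g (i * δ + δ) = ∑ i ∈ Finset.range N, g (i * δ) := by
  cases N with
  | zero => simp
  | succ n =>
    rw [Finset.sum_range_succ, Finset.sum_range_succ' (fun i : ℕ => g (i * δ))]
    push_cast at hg ⊢
    simp only [add_mul, one_mul, zero_mul] at hg ⊢
    rw [hg]

/-- A finite family of half-planes, one with a normal making a positive angle with the direction
of a ray starting in the intersection, is left by the ray through one of the bounding lines. -/
theorem exists_ray_mem_boundary {ι : Type*} {s : Finset ι} {α β h : ι → ℝ}
    (h0 : ∀ i ∈ s, α i ≤ h i) (hβ : ∃ i ∈ s, 0 < β i) :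
    ∃ t : ℝ, 0 ≤ t ∧ (∀ i ∈ s, α i + t * β i ≤ h i) ∧ ∃ i ∈ s, α i + t * β i = h i := by
  obtain ⟨j, hj, hβj⟩ := hβ
  have hs : s.Nonempty := ⟨j, hj⟩
  set g : ℝ → ℝ := fun t => s.sup' hs fun i => α i + t * β i - h i
  have hg : Continuous g := Continuous.finset_sup'_apply hs fun i _ => by fun_prop
  have hb : 0 ≤ (h j - α j) / β j := div_nonneg (sub_nonneg.2 (h0 j hj)) hβj.le
  have hg0 : g 0 ≤ 0 := Finset.sup'_le _ _ fun i hi => by simpa using h0 i hi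
  have hg1 : 0 ≤ g ((h j - α j) / β j) := by
    refine le_trans (le_of_eq ?_) (Finset.le_sup' (fun i => α i + _ * β i - h i) hj)
    field_simp
    ring
  obtain ⟨t, ht, hgt⟩ := intermediate_value_Icc hb hg.continuousOn ⟨hg0, hg1⟩
  refine ⟨t, ht.1, fun i hi => ?_, ?_⟩
  · have := (Finset.le_sup' (fun i => α i + t * β i - h i) hi).trans hgt.le
    linarith
  · obtain ⟨i, hi, hgi⟩ := Finset.exists_mem_eq_sup' hs fun i => α i + t * β i - h i
    exact ⟨i, hi, by have := hgi.symm.trans hgt; linarith⟩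

theorem exists_sum_pos_of_ne_zero {u : EuclideanSpace ℝ (Fin 2)} (hu : u ≠ 0) {m : ℕ}
    (hm : 0 < m) : ∃ i ∈ Finset.range (4 * m),
      0 < u 0 * cos (i * (π / (2 * m))) + u 1 * sin (i * (π / (2 * m))) := by
  have hm' : (m : ℝ) ≠ 0 := by positivity
  have e1 : (m : ℝ) * (π / (2 * m)) = π / 2 := by field_simp
  have e2 : ((2 * m : ℕ) : ℝ) * (π / (2 * m)) = π := by push_cast; field_simp
  have e3 : ((3 * m : ℕ) : ℝ) * (π / (2 * m)) = π / 2 + π := by push_cast; field_simp; ring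
  rcases lt_trichotomy (u 0) 0 with h | h | h
  · refine ⟨2 * m, Finset.mem_range.2 (by omega), ?_⟩
    rw [e2, cos_pi, sin_pi]; linarith
  · rcases lt_trichotomy (u 1) 0 with h' | h' | h'
    · refine ⟨3 * m, Finset.mem_range.2 (by omega), ?_⟩
      rw [e3, cos_add_pi, sin_add_pi, cos_pi_div_two, sin_pi_div_two]; linarith
    · refine absurd ?_ hu
      ext i
      fin_cases i
      · exact h
      · exact h'
    · refine ⟨m, Finset.mem_range.2 (by omega), ?_⟩
      rw [e1, cos_pi_div_two, sin_pi_div_two]; linarith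
  · refine ⟨0, Finset.mem_range.2 (by omega), ?_⟩
    simpa using h

theorem sum_mul_cos_sin_le_dist (x y : EuclideanSpace ℝ (Fin 2)) (θ : ℝ) :
    (x 0 * cos θ + x 1 * sin θ) - (y 0 * cos θ + y 1 * sin θ) ≤ dist x y := by
  rw [EuclideanSpace.dist_eq, Fin.sum_univ_two, Real.dist_eq, Real.dist_eq, sq_abs, sq_abs]
  refine Real.le_sqrt_of_sq_le ?_
  have := sin_sq_add_cos_sq θ
  have h2 : ((x 0 - y 0) ^ 2 + (x 1 - y 1) ^ 2) * (sin θ ^ 2 + cos θ ^ 2) =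
    ((x 0 - y 0) ^ 2 + (x 1 - y 1) ^ 2) := by rw [this, mul_one]
  nlinarith [sq_nonneg ((x 0 - y 0) * sin θ - (x 1 - y 1) * cos θ)]

theorem hausdorffMeasure_frontier_le_circumscribed {K : Set (EuclideanSpace ℝ (Fin 2))}
    (hne : K.Nonempty) (hcpt : IsCompact K) (hcv : Convex ℝ K) {m : ℕ} (hm : 0 < m) :
    μH[1] (frontier K) ≤ ENNReal.ofReal (4 * m * tan (π / (4 * m)) * diam K) := by
  have hm' : (m : ℝ) ≠ 0 := by positivity
  have hm1 : (1 : ℝ) ≤ m := by exact_mod_cast hm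
  obtain ⟨h, hle, heq⟩ : ∃ h : ℝ → ℝ, (∀ θ, ∀ x ∈ K, x 0 * cos θ + x 1 * sin θ ≤ h θ) ∧
      ∀ θ, ∃ x ∈ K, x 0 * cos θ + x 1 * sin θ = h θ := by
    have hmax : ∀ θ : ℝ, ∃ x ∈ K, IsMaxOn
        (fun x : EuclideanSpace ℝ (Fin 2) => x 0 * cos θ + x 1 * sin θ) K x := fun θ =>
      hcpt.exists_isMaxOn hne (by fun_prop)
    choose x hxK hx using hmax
    exact ⟨fun θ => x θ 0 * cos θ + x θ 1 * sin θ, fun θ y hy => hx θ hy,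
      fun θ => ⟨x θ, hxK θ, rfl⟩⟩
  have hper : ∀ θ, h (θ + 2 * π) = h θ := fun θ => by
    obtain ⟨x, hx, hxe⟩ := heq θ
    obtain ⟨y, hy, hye⟩ := heq (θ + 2 * π)
    have h₁ := hle (θ + 2 * π) x hx
    have h₂ := hle θ y hy
    rw [cos_add_two_pi, sin_add_two_pi] at hye h₁
    linarith
  set δ : ℝ := π / (2 * m) with hδ
  have hNδ : ((4 * m : ℕ) : ℝ) * δ = 2 * π := by rw [hδ]; push_cast; field_simp; ring
  have hδ_pos : 0 < δ := by positivity
  have hsin : 0 < sin δ := by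
    refine sin_pos_of_pos_of_lt_pi hδ_pos ?_
    rw [hδ, div_lt_iff₀ (by positivity)]
    nlinarith [pi_pos]
  set edge : ℝ → Set (EuclideanSpace ℝ (Fin 2)) := fun θ =>
    tangentEdge θ δ (h (θ - δ)) (h θ) (h (θ + δ))
  set len : ℝ → ℝ := fun θ => (h (θ - δ) + h (θ + δ) - 2 * h θ * cos δ) / sin δ with hlen
  have hlen_nonneg : ∀ θ, 0 ≤ len θ := fun θ => by
    obtain ⟨x, hx, hxe⟩ := heq θ
    exact tangentEdge_length_nonneg hsin ⟨x, hxe, hle _ x hx, hle _ x hx⟩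
  have hray : ∀ x ∈ K, ∀ u : EuclideanSpace ℝ (Fin 2), u ≠ 0 →
      ∃ s : ℝ, 0 ≤ s ∧ x + s • u ∈ ⋃ i ∈ Finset.range (4 * m), edge (i * δ) := by
    intro x hx u hu
    obtain ⟨t, ht, htle, i, hi, hie⟩ := exists_ray_mem_boundary
      (h := fun i : ℕ => h (i * δ)) (fun i _ => hle (i * δ) x hx) (exists_sum_pos_of_ne_zero hu hm)
    refine ⟨t, ht, ?_⟩
    set y := x + t • u with hy
    have hyx : ∀ θ, y 0 * cos θ + y 1 * sin θ =
        x 0 * cos θ + x 1 * sin θ + t * (u 0 * cos θ + u 1 * sin θ) := fun θ => by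
      simp only [hy, PiLp.add_apply, PiLp.smul_apply, smul_eq_mul]
      ring
    have hC : ∀ j : ℕ, j < 4 * m → y 0 * cos (j * δ) + y 1 * sin (j * δ) ≤ h (j * δ) :=
      fun j hj => (hyx _).trans_le (htle j (Finset.mem_range.2 hj))
    have hCper : ∀ θ, y 0 * cos (θ + 2 * π) + y 1 * sin (θ + 2 * π) ≤ h (θ + 2 * π) ↔
        y 0 * cos θ + y 1 * sin θ ≤ h θ := fun θ => by
      rw [cos_add_two_pi, sin_add_two_pi, hper]
    have hi' := Finset.mem_range.1 hi
    refine Set.mem_biUnion hi ⟨(hyx _).trans hie, ?_, ?_⟩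
    · cases i with
      | zero =>
        rw [← hCper]
        convert hC (4 * m - 1) (by omega) using 4 <;>
        · rw [← hNδ, Nat.cast_sub (by omega)]
          push_cast
          ring
      | succ k =>
        convert hC k (by omega) using 4 <;> push_cast <;> ring
    · rcases Nat.lt_or_ge (i + 1) (4 * m) with hlt | hge
      · convert hC (i + 1) hlt using 4 <;> push_cast <;> ring
      · have hi1 : (i : ℝ) * δ + δ = 0 + 2 * π := by
          rw [← hNδ, show 4 * m = i + 1 by omega]
          push_cast
          ring
        rw [hi1, hCper]
        simpa using hC 0 (by omega)
  have hwidth : ∀ θ, h θ + h (θ + π) ≤ diam K := fun θ => by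
    obtain ⟨x, hx, hxe⟩ := heq θ
    obtain ⟨y, hy, hye⟩ := heq (θ + π)
    rw [cos_add_pi, sin_add_pi] at hye
    have := sum_mul_cos_sin_le_dist x y θ
    have := dist_le_diam_of_mem hcpt.isBounded hx hy
    linarith
  have hsum_h : ∑ i ∈ Finset.range (4 * m), h (i * δ) ≤ 2 * m * diam K := by
    rw [show 4 * m = 2 * m + 2 * m by ring, Finset.sum_range_add, ← Finset.sum_add_distrib]
    refine (Finset.sum_le_card_nsmul _ _ (diam K) fun i _ => ?_).trans_eq (by simp)
    have hshift : ((2 * m + i : ℕ) : ℝ) * δ = i * δ + π := by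
      push_cast
      linarith [show (4 : ℝ) * m * δ = 2 * π by exact_mod_cast hNδ]
    rw [hshift]
    exact hwidth _
  have hsum_succ : ∑ i ∈ Finset.range (4 * m), h (i * δ + δ) =
      ∑ i ∈ Finset.range (4 * m), h (i * δ) := by
    refine sum_range_shift_of_periodic h δ _ ?_
    rw [hNδ, ← hper 0, zero_add]
  have hsum_pred : ∑ i ∈ Finset.range (4 * m), h (i * δ - δ) =
      ∑ i ∈ Finset.range (4 * m), h (i * δ) := by
    have := sum_range_shift_of_periodic (fun θ => h (θ - δ)) δ (4 * m) (by
      simp only [hNδ]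
      rw [← hper (0 - δ)]
      congr 1
      ring)
    simpa using this.symm
  have htan : (2 - 2 * cos δ) / sin δ = 2 * tan (π / (4 * m)) := by
    have hhalf : δ = 2 * (π / (4 * m)) := by rw [hδ]; field_simp; ring
    rw [hhalf, sin_two_mul] at hsin
    rw [hhalf, sin_two_mul, cos_two_mul', tan_eq_sin_div_cos]
    have hs0 : sin (π / (4 * m)) ≠ 0 := fun h0 => by simp [h0] at hsin
    have hc0 : cos (π / (4 * m)) ≠ 0 := fun h0 => by simp [h0] at hsin
    field_simp
    linear_combination -sin_sq_add_cos_sq (π / (4 * m))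
  have hsum_len : ∑ i ∈ Finset.range (4 * m), len (i * δ) ≤
      4 * m * tan (π / (4 * m)) * diam K := by
    have : ∑ i ∈ Finset.range (4 * m), len (i * δ) =
        (2 - 2 * cos δ) / sin δ * ∑ i ∈ Finset.range (4 * m), h (i * δ) := by
      simp only [hlen]
      rw [← Finset.sum_div, Finset.sum_sub_distrib, Finset.sum_add_distrib, ← Finset.sum_mul,
        ← Finset.mul_sum, hsum_succ, hsum_pred]
      ring
    rw [this]
    have hnn : 0 ≤ (2 - 2 * cos δ) / sin δ :=
      div_nonneg (by linarith [cos_le_one δ]) hsin.le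
    refine (mul_le_mul_of_nonneg_left hsum_h hnn).trans_eq ?_
    rw [htan]
    ring
  calc μH[1] (frontier K) ≤ μH[1] (⋃ i ∈ Finset.range (4 * m), edge (i * δ)) :=
        hausdorffMeasure_frontier_le_of_forall_ray_mem hcpt.isClosed hcv hray
    _ ≤ ∑ i ∈ Finset.range (4 * m), μH[1] (edge (i * δ)) := measure_biUnion_finset_le _ _
    _ ≤ ∑ i ∈ Finset.range (4 * m), ENNReal.ofReal (len (i * δ)) :=
        Finset.sum_le_sum fun i _ => hausdorffMeasure_tangentEdge_le hsin
    _ = ENNReal.ofReal (∑ i ∈ Finset.range (4 * m), len (i * δ)) :=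
        (ENNReal.ofReal_sum_of_nonneg fun i _ => hlen_nonneg _).symm
    _ ≤ _ := ENNReal.ofReal_le_ofReal hsum_len

theorem tendsto_mul_tan_pi_div :
    Filter.Tendsto (fun m : ℕ => 4 * (m : ℝ) * tan (π / (4 * m))) Filter.atTop (nhds π) := by
  have hd : HasDerivAt tan 1 0 := by simpa using hasDerivAt_tan (x := 0) (by simp)
  have hx : Filter.Tendsto (fun m : ℕ => π / (4 * (m : ℝ))) Filter.atTop
      (nhdsWithin 0 {0}ᶜ) := by
    refine tendsto_nhdsWithin_iff.2 ⟨?_, ?_⟩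
    · exact Filter.Tendsto.div_atTop tendsto_const_nhds
        (tendsto_natCast_atTop_atTop.const_mul_atTop (by norm_num))
    · filter_upwards [Filter.eventually_gt_atTop 0] with m hm
      have : (0 : ℝ) < π / (4 * m) := by positivity
      exact this.ne'
  have := ((hasDerivAt_iff_tendsto_slope.1 hd).comp hx).const_mul π
  rw [mul_one] at this
  refine this.congr' ?_
  filter_upwards [Filter.eventually_gt_atTop 0] with m hm
  have hm' : (m : ℝ) ≠ 0 := by positivity
  simp only [Function.comp, slope_def_field, tan_zero, sub_zero]
  field_simp

/-- A planar convex body has perimeter at most `π` times its diameter. -/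
theorem hausdorffMeasure_frontier_le_pi_mul_diam {K : Set (EuclideanSpace ℝ (Fin 2))}
    (hne : K.Nonempty) (hcpt : IsCompact K) (hcv : Convex ℝ K) :
    μH[1] (frontier K) ≤ ENNReal.ofReal (π * diam K) := by
  refine ge_of_tendsto (ENNReal.tendsto_ofReal (tendsto_mul_tan_pi_div.mul_const (diam K))) ?_
  filter_upwards [Filter.eventually_gt_atTop 0] with m hm
  exact hausdorffMeasure_frontier_le_circumscribed hne hcpt hcv hm

theorem volume_le_diam_sq {K : Set (EuclideanSpace ℝ (Fin 2))} (hne : K.Nonempty)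
    (hcpt : IsCompact K) : volume K ≤ ENNReal.ofReal (diam K ^ 2) := by
  have hmin : ∀ i : Fin 2, ∃ x ∈ K, IsMinOn (fun x : EuclideanSpace ℝ (Fin 2) => x i) K x :=
    fun i => hcpt.exists_isMinOn hne (by fun_prop)
  choose x hxK hx using hmin
  set a : Fin 2 → ℝ := fun i => x i i
  have hsub : K ⊆ WithLp.ofLp ⁻¹' Set.Icc a (fun i => a i + diam K) := by
    refine fun y hy => ⟨fun i => hx i hy, fun i => ?_⟩
    have h1 : y i - x i i ≤ dist y (x i) := by
      rw [dist_eq_norm]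
      exact (le_abs_self _).trans (PiLp.norm_apply_le (y - x i) i)
    have h2 := dist_le_diam_of_mem hcpt.isBounded hy (hxK i)
    change y i ≤ x i i + diam K
    linarith
  refine (measure_mono hsub).trans_eq ?_
  rw [(PiLp.volume_preserving_ofLp (Fin 2)).measure_preimage
    measurableSet_Icc.nullMeasurableSet, Real.volume_Icc_pi]
  simp [pow_two, ENNReal.ofReal_mul diam_nonneg]

theorem sum_Icc_two_sub_le {f : ℕ → ℝ} {T : ℕ} (hT : 1 ≤ T) (hf : 0 ≤ f T) :
    ∑ t ∈ Finset.Icc 2 T, (f (t - 1) - f t) ≤ f 1 := by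
  have : ∀ n, ∑ t ∈ Finset.Icc 2 (n + 1), (f (t - 1) - f t) = f 1 - f (n + 1) := fun n => by
    induction n with
    | zero => simp
    | succ n ih =>
      rw [Finset.sum_Icc_succ_top (by omega), ih, Nat.add_sub_cancel]
      ring
  have := this (T - 1)
  rw [Nat.sub_add_cancel hT] at this
  linarith

theorem sum_proj_costs_bound (T : ℕ) (D c : ℝ) (hD : 0 < D) (hc : 0 < c)
    (S : ℕ → Set (EuclideanSpace ℝ (Fin 2)))
    (hne : ∀ t, 1 ≤ t → t ≤ T → (S t).Nonempty)
    (hcpt : ∀ t, 1 ≤ t → t ≤ T → IsCompact (S t))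
    (hcv : ∀ t, 1 ≤ t → t ≤ T → Convex ℝ (S t))
    (hnest : ∀ t, 2 ≤ t → t ≤ T → S t ⊆ S (t - 1))
    (hdiam : ∀ t, 1 ≤ t → t ≤ T → diam (S t) ≤ D)
    (r : ℕ → ℝ) (hr : ∀ t, 0 ≤ r t)
    (halt : ∀ t, 2 ≤ t → t ≤ T →
      (μH[1] (frontier (S (t - 1)))).toReal - (μH[1] (frontier (S t))).toReal
          ≥ c * r t ∨
      (volume (S (t - 1))).toReal - (volume (S t)).toReal ≥ c * r t ^ 2) :
    ∑ t ∈ Finset.Icc 2 T, r t ≤ π * D / c + Real.sqrt (T * D ^ 2 / c) := by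
  rcases Nat.eq_zero_or_pos T with rfl | hT
  · simp only [Nat.ofNat_pos, Finset.Icc_eq_empty_of_lt, Finset.sum_empty]
    positivity
  set P : ℕ → ℝ := fun t => (μH[1] (frontier (S t))).toReal
  set A : ℕ → ℝ := fun t => (volume (S t)).toReal
  have hPle : ∀ t, 1 ≤ t → t ≤ T →
      μH[1] (frontier (S t)) ≤ ENNReal.ofReal (π * diam (S t)) := fun t h1 hT =>
    hausdorffMeasure_frontier_le_pi_mul_diam (hne t h1 hT) (hcpt t h1 hT) (hcv t h1 hT)
  have hP1 : P 1 ≤ π * D :=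
    (ENNReal.toReal_le_of_le_ofReal (by positivity) (hPle 1 le_rfl hT)).trans
      (by gcongr; exact hdiam 1 le_rfl hT)
  have hA1 : A 1 ≤ D ^ 2 :=
    (ENNReal.toReal_le_of_le_ofReal (by positivity)
      (volume_le_diam_sq (hne 1 le_rfl hT) (hcpt 1 le_rfl hT))).trans
      (by gcongr; exact hdiam 1 le_rfl hT)
  have hPmono : ∀ t ∈ Finset.Icc 2 T, 0 ≤ P (t - 1) - P t := fun t ht => by
    obtain ⟨h2, htT⟩ := Finset.mem_Icc.1 ht
    refine sub_nonneg.2 (ENNReal.toReal_mono ?_ ?_)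
    · exact ne_top_of_le_ne_top ENNReal.ofReal_ne_top (hPle (t - 1) (by omega) (by omega))
    · exact hausdorffMeasure_frontier_mono (hcpt t (by omega) htT).isClosed
        (hcv t (by omega) htT) (hcpt (t - 1) (by omega) (by omega)) (hnest t h2 htT)
  have hAmono : ∀ t ∈ Finset.Icc 2 T, 0 ≤ A (t - 1) - A t := fun t ht => by
    obtain ⟨h2, htT⟩ := Finset.mem_Icc.1 ht
    exact sub_nonneg.2 (ENNReal.toReal_mono
      (hcpt (t - 1) (by omega) (by omega)).measure_lt_top.ne (measure_mono (hnest t h2 htT)))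
  classical
  set I := Finset.Icc 2 T
  set IP := I.filter fun t => c * r t ≤ P (t - 1) - P t
  set IA := I.filter fun t => ¬ c * r t ≤ P (t - 1) - P t
  have hIP : ∑ t ∈ IP, r t ≤ π * D / c := by
    rw [le_div_iff₀' hc, Finset.mul_sum]
    calc ∑ t ∈ IP, c * r t ≤ ∑ t ∈ IP, (P (t - 1) - P t) :=
          Finset.sum_le_sum fun t ht => (Finset.mem_filter.1 ht).2
      _ ≤ ∑ t ∈ I, (P (t - 1) - P t) :=
          Finset.sum_le_sum_of_subset_of_nonneg (Finset.filter_subset _ _)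
            fun t ht _ => hPmono t ht
      _ ≤ P 1 := sum_Icc_two_sub_le hT ENNReal.toReal_nonneg
      _ ≤ π * D := hP1
  have hIAsq : ∑ t ∈ IA, r t ^ 2 ≤ D ^ 2 / c := by
    rw [le_div_iff₀' hc, Finset.mul_sum]
    calc ∑ t ∈ IA, c * r t ^ 2 ≤ ∑ t ∈ IA, (A (t - 1) - A t) :=
          Finset.sum_le_sum fun t ht => by
            obtain ⟨htI, htP⟩ := Finset.mem_filter.1 ht
            obtain ⟨h2, htT⟩ := Finset.mem_Icc.1 htI
            exact (halt t h2 htT).resolve_left htP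
      _ ≤ ∑ t ∈ I, (A (t - 1) - A t) :=
          Finset.sum_le_sum_of_subset_of_nonneg (Finset.filter_subset _ _)
            fun t ht _ => hAmono t ht
      _ ≤ A 1 := sum_Icc_two_sub_le hT ENNReal.toReal_nonneg
      _ ≤ D ^ 2 := hA1
  have hcard : (IA.card : ℝ) ≤ T := by
    have : IA.card ≤ I.card := Finset.card_filter_le _ _
    rw [Nat.card_Icc] at this
    exact_mod_cast this.trans (by omega)
  have hIA : ∑ t ∈ IA, r t ≤ Real.sqrt (T * D ^ 2 / c) := by
    refine Real.le_sqrt_of_sq_le ?_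
    calc (∑ t ∈ IA, r t) ^ 2 ≤ IA.card * ∑ t ∈ IA, r t ^ 2 := sq_sum_le_card_mul_sum_sq
      _ ≤ T * (D ^ 2 / c) := by gcongr
      _ = T * D ^ 2 / c := by ring
  rw [← Finset.sum_filter_add_sum_filter_not I fun t => c * r t ≤ P (t - 1) - P t]
  exact add_le_add hIP hIA
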